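/- Let w_1, ..., w_4 ∈ ℝ^d be unit vectors with |⟨w_i, w_j⟩| ≤ δ for all i ≠ j, let μ_1,...,μ_4 ∈ ℝ, let g be a standard Gaussian vector in ℝ^d, and define y_i = -1 if ⟨g, w_i⟩ ≤ μ_i and y_i = +1 otherwise. Then for every b ∈ {-1,+1}^4, |Pr[(y_1,y_2,y_3,y_4) = b] − Π_{i=1}^4 Pr[y_i = b_i]| = O(δ^{1/4}). -/

import Mathlib

open MeasureTheory ProbabilityTheory

lemma aux_tele {Ω : Type*} [MeasurableSpace Ω] (P : Measure Ω) [IsProbabilityMeasure P]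
    (A B : Fin 4 → Set Ω) (hA : ∀ i, MeasurableSet (A i)) (hB : ∀ i, MeasurableSet (B i)) (η : ℝ)
    (h : ∀ i, P.real (symmDiff (A i) (B i)) ≤ η)
    (hind : P.real (⋂ i, B i) = ∏ i, P.real (B i)) :
    |P.real (⋂ i, A i) - ∏ i, P.real (A i)| ≤ 8 * η := by
  have h1 : |P.real (⋂ i, A i) - P.real (⋂ i, B i)| ≤ 4 * η := by
    refine (abs_measureReal_sub_le_measureReal_symmDiff (MeasurableSet.iInter hA).nullMeasurableSet
      (MeasurableSet.iInter hB).nullMeasurableSet).trans ?_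
    have hs : symmDiff (⋂ i, A i) (⋂ i, B i) ⊆ ⋃ i, symmDiff (A i) (B i) := by
      intro x hx
      simp only [Set.mem_symmDiff, Set.mem_iInter, Set.mem_iUnion] at hx ⊢
      by_contra hc
      push Not at hc
      rcases hx with ⟨ha, hb⟩ | ⟨ha, hb⟩
      · exact hb fun i => (hc i).1 (ha i)
      · exact hb fun i => (hc i).2 (ha i)
    refine (measureReal_mono hs).trans ((measureReal_iUnion_fintype_le _).trans ?_)
    refine (Finset.sum_le_sum fun i _ => h i).trans ?_
    simp
  have h2 : ∀ i, |P.real (A i) - P.real (B i)| ≤ η := fun i =>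
    (abs_measureReal_sub_le_measureReal_symmDiff (hA i).nullMeasurableSet
      (hB i).nullMeasurableSet).trans (h i)
  have h3 : ∀ a b c d a' b' : ℝ, 0 ≤ a → a ≤ 1 → 0 ≤ b' → b' ≤ 1 → |a - a'| ≤ c → |b - b'| ≤ d →
      |a * b - a' * b'| ≤ c + d := by
    intro a b c d a' b' ha ha1 hb hb1 h h'
    have : a * b - a' * b' = a * (b - b') + (a - a') * b' := by ring
    rw [this]
    refine (abs_add_le _ _).trans ?_
    rw [abs_mul, abs_mul, abs_of_nonneg ha, abs_of_nonneg hb]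
    nlinarith [abs_nonneg (a - a'), abs_nonneg (b - b')]
  have h0 : ∀ S, 0 ≤ P.real S := fun S => measureReal_nonneg
  have h1' : ∀ S, P.real S ≤ 1 := fun S => measureReal_le_one
  have h4 : |∏ i, P.real (A i) - ∏ i, P.real (B i)| ≤ 4 * η := by
    rw [Fin.prod_univ_four, Fin.prod_univ_four]
    have e1 := h3 _ _ _ _ _ _ (h0 (A 0)) (h1' _) (h0 (B 1)) (h1' _) (h2 0) (h2 1)
    have e2 := h3 _ _ _ _ _ _ (mul_nonneg (h0 (A 0)) (h0 (A 1)))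
      (mul_le_one₀ (h1' _) (h0 _) (h1' _)) (h0 (B 2)) (h1' _) e1 (h2 2)
    have e3 := h3 _ _ _ _ _ _ (mul_nonneg (mul_nonneg (h0 (A 0)) (h0 (A 1))) (h0 (A 2)))
      (mul_le_one₀ (mul_le_one₀ (h1' _) (h0 _) (h1' _)) (h0 _) (h1' _)) (h0 (B 3)) (h1' _) e2 (h2 3)
    linarith
  rw [abs_le] at *
  constructor <;> linarith [h1.1, h1.2, h4.1, h4.2]

open InnerProductSpace in
lemma aux_gs {E : Type*} [NormedAddCommGroup E] [InnerProductSpace ℝ E] (w : Fin 4 → E) (δ : ℝ)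
    (hδ0 : 0 ≤ δ) (hδ : δ ≤ 1 / 48) (hw : ∀ i, ‖w i‖ = 1)
    (h : ∀ i j, i ≠ j → |inner ℝ (w i) (w j)| ≤ δ) :
    ∃ v : Fin 4 → E, (∀ i j, i ≠ j → inner ℝ (v i) (v j) = 0) ∧ ∀ i, ‖v i - w i‖ ≤ 12 * δ := by
  refine ⟨gramSchmidt ℝ w, fun i j hij => gramSchmidt_orthogonal ℝ w hij, ?_⟩
  set v := gramSchmidt ℝ w with hv
  have key : ∀ n : Fin 4, (∀ i, n < i → |inner ℝ (v n) (w i)| ≤ 2 * δ) ∧ ‖v n - w n‖ ≤ 12 * δ := by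
    intro n
    induction n using WellFoundedLT.induction with
    | ind n ih =>
    have hdef : w n = v n + ∑ i ∈ Finset.Iio n, (inner ℝ (v i) (w n) / ‖v i‖ ^ 2) • v i := by
      simpa using gramSchmidt_def'' ℝ w n
    have hcard : ((Finset.Iio n).card : ℝ) ≤ 3 := by
      rw [Fin.card_Iio]
      have : (n : ℕ) ≤ 3 := by omega
      exact_mod_cast this
    have hlow : ∀ i ∈ Finset.Iio n, 1 / 2 ≤ ‖v i‖ := by
      intro i hi
      have h1 := (ih i (Finset.mem_Iio.1 hi)).2
      have h2 := norm_sub_norm_le (w i) (v i)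
      rw [norm_sub_rev, hw] at h2
      linarith
    have hmain : ∀ i ∈ Finset.Iio n, |inner ℝ (v i) (w n)| ≤ 2 * δ := fun i hi =>
      (ih i (Finset.mem_Iio.1 hi)).1 n (Finset.mem_Iio.1 hi)
    have hvn : v n = w n - ∑ i ∈ Finset.Iio n, (inner ℝ (v i) (w n) / ‖v i‖ ^ 2) • v i := by
      rw [eq_sub_iff_add_eq, ← hdef]
    constructor
    · intro k hk
      rw [hvn, inner_sub_left, sum_inner]
      refine (abs_sub _ _).trans ?_
      have : |∑ i ∈ Finset.Iio n, inner ℝ ((inner ℝ (v i) (w n) / ‖v i‖ ^ 2) • v i) (w k)|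
          ≤ ∑ i ∈ Finset.Iio n, 16 * δ ^ 2 := by
        refine (Finset.abs_sum_le_sum_abs _ _).trans (Finset.sum_le_sum fun i hi => ?_)
        rw [real_inner_smul_left, abs_mul, abs_div, abs_of_nonneg (sq_nonneg ‖v i‖)]
        have h1 := hmain i hi
        have h2 := (ih i (Finset.mem_Iio.1 hi)).1 k ((Finset.mem_Iio.1 hi).trans hk)
        have h3 := hlow i hi
        rw [div_mul_eq_mul_div, div_le_iff₀ (by positivity)]
        have h4 := mul_le_mul h1 h2 (abs_nonneg _) (by positivity)
        have h5 : 1 / 4 ≤ ‖v i‖ ^ 2 := by nlinarith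
        nlinarith [sq_nonneg δ]
      rw [Finset.sum_const, nsmul_eq_mul] at this
      have h6 := h n k hk.ne
      nlinarith [sq_nonneg δ]
    · have : v n - w n = - ∑ i ∈ Finset.Iio n, (inner ℝ (v i) (w n) / ‖v i‖ ^ 2) • v i := by
        rw [hvn]; simp
      rw [this, norm_neg]
      have : ‖∑ i ∈ Finset.Iio n, (inner ℝ (v i) (w n) / ‖v i‖ ^ 2) • v i‖
          ≤ ∑ i ∈ Finset.Iio n, 4 * δ := by
        refine (norm_sum_le _ _).trans (Finset.sum_le_sum fun i hi => ?_)
        have h1 := hmain i hi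
        have h3 := hlow i hi
        rw [norm_smul, Real.norm_eq_abs, abs_div, abs_of_nonneg (sq_nonneg ‖v i‖),
          div_mul_eq_mul_div, div_le_iff₀ (by positivity)]
        nlinarith [mul_le_mul_of_nonneg_right h1 (norm_nonneg (v i)),
          mul_nonneg hδ0 (mul_nonneg (norm_nonneg (v i)) (sub_nonneg.2 h3))]
      rw [Finset.sum_const, nsmul_eq_mul] at this
      nlinarith
  exact fun i => (key i).2

lemma aux_anti (a ε : ℝ) (hε : 0 ≤ ε) :
    gaussianReal 0 1 (Set.Icc (a - ε) (a + ε)) ≤ ENNReal.ofReal (2 * ε) := by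
  rw [gaussianReal_apply _ one_ne_zero]
  calc _ ≤ ∫⁻ x in Set.Icc (a - ε) (a + ε), 1 := by
        refine lintegral_mono fun x => ?_
        rw [gaussianPDF, ENNReal.ofReal_le_one, gaussianPDFReal]
        refine mul_le_one₀ ?_ (Real.exp_nonneg _) ?_
        · refine inv_le_one_of_one_le₀ ?_
          rw [Real.one_le_sqrt]
          have := Real.pi_gt_three
          simp; linarith
        · rw [Real.exp_le_one_iff]
          have := sq_nonneg (x - 0)
          simp only [NNReal.coe_one]
          linarith
    _ = _ := by
      rw [setLIntegral_one, Real.volume_Icc]; congr 1; ring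

section
variable {d : ℕ}
local notation "E" => EuclideanSpace ℝ (Fin d)

lemma aux_law (w : E) (hw : ‖w‖ = 1) :
    (stdGaussian E).map (fun g => inner ℝ w g) = gaussianReal 0 1 := by
  have h := IsGaussian.map_eq_gaussianReal (μ := stdGaussian E) (innerSL ℝ w)
  rw [integral_strongDual_stdGaussian, variance_dual_stdGaussian, innerSL_apply_norm, hw] at h
  simpa using h

lemma aux_cheb (u : E) (ε : ℝ) (hε : 0 < ε) :
    (stdGaussian E) {g | ε ≤ |inner ℝ u g|} ≤ ENNReal.ofReal (‖u‖ ^ 2 / ε ^ 2) := by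
  have h := meas_ge_le_variance_div_sq (IsGaussian.memLp_dual (stdGaussian E) (innerSL ℝ u) 2 (by simp)) hε
  rw [integral_strongDual_stdGaussian, variance_dual_stdGaussian, innerSL_apply_norm] at h
  simpa using h

lemma aux_indep (v : Fin 4 → E) (hv : ∀ i j, i ≠ j → inner ℝ (v i) (v j) = 0) :
    iIndepFun (fun i (g : E) => inner ℝ (v i) g) (stdGaussian E) := by
  apply HasGaussianLaw.iIndepFun_of_covariance_eq_zero
  · exact (IsGaussian.hasGaussianLaw_id (μ := stdGaussian E)).map
      (ContinuousLinearMap.pi fun i => innerSL ℝ (v i))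
  · intro i j hij
    have := covarianceBilin_apply_eq_cov (μ := stdGaussian E) IsGaussian.memLp_two_id (v i) (v j)
    rw [covarianceBilin_stdGaussian] at this
    rw [← this]
    exact hv i j hij

lemma aux_symm (w v : E) (hw : ‖w‖ = 1) (a ε : ℝ) (hε : 0 < ε) (S : Set ℝ) 
    (hS : S = Set.Iic a ∨ S = Set.Ioi a) :
    (stdGaussian E).real (symmDiff ((fun g : E => inner ℝ w g) ⁻¹' S) ((fun g : E => inner ℝ v g) ⁻¹' S)) ≤ 
      2 * ε + ‖v - w‖ ^ 2 / ε ^ 2 := by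
  have hs : symmDiff ((fun g : E => inner ℝ w g) ⁻¹' S) ((fun g : E => inner ℝ v g) ⁻¹' S) ⊆
     ((fun g : E => inner ℝ w g) ⁻¹' (Set.Icc (a - ε) (a + ε))) ∪ {g | ε ≤ |inner ℝ (v - w) g|} := by
    intro g hg
    by_contra hc
    simp only [Set.mem_union, Set.mem_preimage, Set.mem_Icc, Set.mem_ofPred_eq, not_or, not_and_or, not_le, inner_sub_left, abs_lt] at hc
    obtain ⟨h1, h2, h3⟩ := hc
    rcases hS with rfl | rfl <;>
    simp only [Set.mem_symmDiff, Set.mem_preimage, Set.mem_Iic, Set.mem_Ioi, not_le, not_lt] at hg <;>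
    rcases hg with ⟨h4, h5⟩ | ⟨h4, h5⟩ <;> rcases h1 with h1 | h1 <;> linarith
  refine ENNReal.toReal_le_of_le_ofReal (by positivity) ?_
  refine (measure_mono hs).trans ((measure_union_le _ _).trans ?_)
  rw [ENNReal.ofReal_add (by positivity) (by positivity)]
  refine add_le_add ?_ (aux_cheb _ _ hε)
  rw [← Measure.map_apply (by fun_prop) measurableSet_Icc, aux_law w hw]
  exact aux_anti a ε hε.le
end


/-- Let `w₁, …, w₄ ∈ ℝ^d` be unit vectors with pairwise inner products at most `δ`
in absolute value, let `μᵢ ∈ ℝ`, let `g` be a standard Gaussian vector in `ℝ^d`, and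
set `yᵢ = -1` if `⟨g, wᵢ⟩ ≤ μᵢ` and `yᵢ = +1` otherwise. Then for every
`b ∈ {-1,+1}⁴`, `|Pr[(y₁,…,y₄) = b] − ∏ᵢ Pr[yᵢ = bᵢ]| = O(δ^{1/4})`, with an
absolute implied constant. -/
theorem gaussian_rounding_near_independence :
    ∃ C : ℝ, 0 < C ∧
      ∀ (d : ℕ) (δ : ℝ) (w : Fin 4 → Fin d → ℝ) (μ : Fin 4 → ℝ) (b : Fin 4 → ℤ),
        (∀ i, ∑ j, (w i j) ^ 2 = 1) →
        (∀ i i', i ≠ i' → |∑ j, w i j * w i' j| ≤ δ) →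
        (∀ i, b i = 1 ∨ b i = -1) →
        |((Measure.pi fun _ : Fin d => gaussianReal 0 1)
            {g : Fin d → ℝ |
              ∀ i, (if ∑ j, g j * w i j ≤ μ i then (-1 : ℤ) else 1) = b i}).toReal
          - ∏ i, ((Measure.pi fun _ : Fin d => gaussianReal 0 1)
            {g : Fin d → ℝ |
              (if ∑ j, g j * w i j ≤ μ i then (-1 : ℤ) else 1) = b i}).toReal|
          ≤ C * δ ^ ((1 : ℝ) / 4) := by
  refine ⟨1168, by norm_num, ?_⟩
  intro d δ w μ b hw hδ hb
  have hδ0 : 0 ≤ δ := (abs_nonneg _).trans (hδ 0 1 (by decide))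
  let W : Fin 4 → EuclideanSpace ℝ (Fin d) := fun i => WithLp.toLp 2 (w i)
  let S : Fin 4 → Set ℝ := fun i => {x | (if x ≤ μ i then (-1 : ℤ) else 1) = b i}
  have hS : ∀ i, S i = Set.Iic (μ i) ∨ S i = Set.Ioi (μ i) := by
    intro i
    rcases hb i with h | h
    · right
      ext x
      by_cases hx : x ≤ μ i <;> simp [S, h, hx]
    · left
      ext x
      by_cases hx : x ≤ μ i <;> simp [S, h, hx]
  have hSm : ∀ i, MeasurableSet (S i) := by
    intro i
    rcases hS i with h | h <;> rw [h]
    exacts [measurableSet_Iic, measurableSet_Ioi]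
  let P := stdGaussian (EuclideanSpace ℝ (Fin d))
  let A : Fin 4 → Set (EuclideanSpace ℝ (Fin d)) := fun i => (fun g => inner ℝ (W i) g) ⁻¹' (S i)
  have hAm : ∀ i, MeasurableSet (A i) := fun i => (hSm i).preimage (by fun_prop)
  have hin : ∀ i (g : Fin d → ℝ), inner ℝ (W i) (WithLp.toLp 2 g) = ∑ j, g j * w i j := by
    intro i g
    simp [W, PiLp.inner_apply]
  have hmap : ∀ T : Set (EuclideanSpace ℝ (Fin d)), MeasurableSet T →
      (Measure.pi fun _ : Fin d => gaussianReal 0 1) (WithLp.toLp 2 ⁻¹' T) = P T := by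
    intro T hT
    rw [← Measure.map_apply (by fun_prop) hT, map_pi_eq_stdGaussian]
  have e1 : {g : Fin d → ℝ | ∀ i, (if ∑ j, g j * w i j ≤ μ i then (-1 : ℤ) else 1) = b i}
      = WithLp.toLp 2 ⁻¹' (⋂ i, A i) := by
    ext g
    simp [A, S, hin]
  have e2 : ∀ i, {g : Fin d → ℝ | (if ∑ j, g j * w i j ≤ μ i then (-1 : ℤ) else 1) = b i}
      = WithLp.toLp 2 ⁻¹' (A i) := by
    intro i
    ext g
    simp [A, S, hin]
  rw [e1, hmap _ (MeasurableSet.iInter hAm)]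
  simp_rw [e2, fun i => hmap _ (hAm i)]
  change |P.real (⋂ i, A i) - ∏ i, P.real (A i)| ≤ _
  by_cases hsmall : δ ≤ 1 / 48
  swap
  · have h1 : (1 / 48 : ℝ) ≤ δ ^ ((1 : ℝ) / 4) := by
      calc (1 / 48 : ℝ) = (1 / 48 : ℝ) ^ (1 : ℝ) := by simp
        _ ≤ (1 / 48 : ℝ) ^ ((1 : ℝ) / 4) :=
          Real.rpow_le_rpow_of_exponent_ge (by norm_num) (by norm_num) (by norm_num)
        _ ≤ _ := Real.rpow_le_rpow (by norm_num) (le_of_not_ge hsmall) (by norm_num)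
    have h2 : |P.real (⋂ i, A i) - ∏ i, P.real (A i)| ≤ 1 := by
      have a1 : 0 ≤ ∏ i, P.real (A i) := Finset.prod_nonneg fun i _ => measureReal_nonneg
      have a2 : ∏ i, P.real (A i) ≤ 1 :=
        Finset.prod_le_one (fun i _ => measureReal_nonneg) (fun i _ => measureReal_le_one)
      have a3 : 0 ≤ P.real (⋂ i, A i) := measureReal_nonneg
      have a4 : P.real (⋂ i, A i) ≤ 1 := measureReal_le_one
      rw [abs_le]
      constructor <;> linarith
    linarith
  have hWn : ∀ i, ‖W i‖ = 1 := by
    intro i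
    rw [EuclideanSpace.norm_eq]
    simp [W, hw]
  obtain ⟨v, hv1, hv2⟩ := aux_gs W δ hδ0 hsmall hWn (by
    intro i j hij
    rw [show inner ℝ (W i) (W j) = ∑ k, w j k * w i k from hin i (w j)]
    exact hδ j i hij.symm)
  have hind : P.real (⋂ i, (fun g => inner ℝ (v i) g) ⁻¹' (S i))
      = ∏ i, P.real ((fun g => inner ℝ (v i) g) ⁻¹' (S i)) := by
    have := (aux_indep v hv1).measure_inter_preimage_eq_mul Finset.univ (sets := S)
      (fun i _ => hSm i)
    simp only [Finset.mem_univ, Set.iInter_true] at this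
    simp only [Measure.real]
    rw [this, ENNReal.toReal_prod]
  have hη : ∀ i, P.real (symmDiff (A i) ((fun g => inner ℝ (v i) g) ⁻¹' (S i)))
      ≤ 146 * δ ^ ((1 : ℝ) / 4) := by
    intro i
    rcases hδ0.eq_or_lt with h0 | hpos
    · have : v i = W i := by
        have := hv2 i
        rw [← h0, mul_zero] at this
        exact sub_eq_zero.1 (norm_le_zero_iff.1 this)
      rw [this]
      simp only [A, symmDiff_self]
      have : 0 ≤ δ ^ ((1 : ℝ) / 4) := by positivity
      simpa using this
    · have h1 := aux_symm (W i) (v i) (hWn i) (μ i) (δ ^ ((1 : ℝ) / 2)) (by positivity) (S i) (hS i)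
      refine h1.trans ?_
      have hd1 : δ ≤ 1 := by linarith
      have h2 : (δ ^ ((1 : ℝ) / 2)) ^ 2 = δ := by
        rw [← Real.sqrt_eq_rpow, Real.sq_sqrt hδ0]
      have h3 : δ ^ ((1 : ℝ) / 2) ≤ δ ^ ((1 : ℝ) / 4) :=
        Real.rpow_le_rpow_of_exponent_ge hpos hd1 (by norm_num)
      have h4 : δ ≤ δ ^ ((1 : ℝ) / 4) := by
        calc δ = δ ^ (1 : ℝ) := by simp
          _ ≤ _ := Real.rpow_le_rpow_of_exponent_ge hpos hd1 (by norm_num)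
      have h5 : ‖v i - W i‖ ^ 2 / (δ ^ ((1 : ℝ) / 2)) ^ 2 ≤ 144 * δ := by
        rw [h2, div_le_iff₀ hpos]
        nlinarith [hv2 i, norm_nonneg (v i - W i)]
      linarith
  have := aux_tele P A _ hAm (fun i => (hSm i).preimage (by fun_prop)) _ hη hind
  linarith
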